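/- Let F₀ be a number field of degree 2g and σ : F₀ → F₀ a ℚ-algebra automorphism with σ ≠ id such that ρ(σ(a)) = conj(ρ(a)) for every ring embedding ρ : F₀ → ℂ. Let Φ be a set of embeddings F₀ → ℂ such that for every embedding τ, exactly one of τ and τ∘σ belongs to Φ. Regard V = F₀ as a ℚ-vector space with the symmetric positive definite bilinear form B(x,y) = Tr_{F₀/ℚ}(x·σ(y)), and set W_Φ := Σ_{τ∈Φ} V_τ ⊆ V_ℂ, where V_τ := {v ∈ F₀ ⊗_ℚ ℂ : (a ⊗ 1)v = τ(a)·v for all a ∈ F₀}. Then dim_ℂ W_Φ = g, W_Φ is isotropic for B_ℂ, W_Φ is stable under a ⊗ 1 for every a ∈ F₀, and V_ℂ = W_Φ ⊕ c(W_Φ). -/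

import Mathlib

open TensorProduct

/-- The action of `a ∈ K` on `ℂ ⊗[ℚ] V`, i.e. `a ⊗ 1`. -/
noncomputable def actionC (K V : Type*) [Field K] [Algebra ℚ K] [AddCommGroup V]
    [Module ℚ V] [Module K V] [IsScalarTower ℚ K V] (a : K) :
    (ℂ ⊗[ℚ] V) →ₗ[ℂ] (ℂ ⊗[ℚ] V) :=
  LinearMap.baseChange ℂ ((LinearMap.lsmul K V a).restrictScalars ℚ)

/-- Complex conjugation `c = id_V ⊗ conj` on `V_ℂ = ℂ ⊗[ℚ] V`. -/
noncomputable def conjC (V : Type*) [AddCommGroup V] [Module ℚ V] :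
    (ℂ ⊗[ℚ] V) →ₗ[ℚ] (ℂ ⊗[ℚ] V) :=
  LinearMap.rTensor V ((Complex.conjAe.toLinearMap).restrictScalars ℚ)

/-- The eigenspace `V_τ` attached to an embedding `τ : K → ℂ`. -/
noncomputable def eigenspaceC (K V : Type*) [Field K] [Algebra ℚ K] [AddCommGroup V]
    [Module ℚ V] [Module K V] [IsScalarTower ℚ K V] (τ : K →+* ℂ) :
    Submodule ℂ (ℂ ⊗[ℚ] V) where
  carrier := {v | ∀ a : K, actionC K V a v = τ a • v}
  add_mem' := by
    intro x y hx hy a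
    simp [map_add, hx a, hy a, smul_add]
  zero_mem' := by
    intro a
    simp
  smul_mem' := by
    intro z v hv a
    rw [map_smul, hv a, smul_comm]

open NumberField

section Coordinates

variable (K : Type*) [Field K] [NumberField K]

/-- The isomorphism `ℂ ⊗ K ≃ ∏_τ ℂ`, `z ⊗ a ↦ (z * τ a)_τ`. -/
noncomputable def embeddingCoords : (ℂ ⊗[ℚ] K) ≃ₗ[ℂ] ((K →+* ℂ) → ℂ) :=
  ((integralBasis K).baseChange ℂ).equiv (canonicalEmbedding.latticeBasis K) (Equiv.refl _)

variable {K}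

@[simp]
lemma embeddingCoords_tmul (z : ℂ) (a : K) (ρ : K →+* ℂ) :
    embeddingCoords K (z ⊗ₜ a) ρ = z * ρ a := by
  have key : ((embeddingCoords K).toLinearMap.restrictScalars ℚ) ∘ₗ TensorProduct.mk ℚ ℂ K 1 =
      (canonicalEmbedding K).toRatAlgHom.toLinearMap := by
    refine (integralBasis K).ext fun i ↦ ?_
    have h := ((integralBasis K).baseChange ℂ).equiv_apply i
      (canonicalEmbedding.latticeBasis K) (Equiv.refl _)
    rw [Module.Basis.baseChange_apply, Equiv.refl_apply,
      canonicalEmbedding.latticeBasis_apply] at h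
    exact h
  have h1 : embeddingCoords K (1 ⊗ₜ a) = canonicalEmbedding K a := LinearMap.congr_fun key a
  have hz : z ⊗ₜ[ℚ] a = z • ((1 : ℂ) ⊗ₜ[ℚ] a) := by
    rw [TensorProduct.smul_tmul', smul_eq_mul, mul_one]
  rw [hz, map_smul, h1, Pi.smul_apply, smul_eq_mul, canonicalEmbedding.apply_at]

lemma embeddingCoords_actionC (a : K) (v : ℂ ⊗[ℚ] K) (ρ : K →+* ℂ) :
    embeddingCoords K (actionC K K a v) ρ = ρ a * embeddingCoords K v ρ := by
  induction v with
  | zero => simp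
  | add x y hx hy => simp [hx, hy, mul_add]
  | tmul z b =>
    simp only [actionC, LinearMap.baseChange_tmul, LinearMap.coe_restrictScalars,
      LinearMap.lsmul_apply, smul_eq_mul, embeddingCoords_tmul, map_mul]
    ring

lemma embeddingCoords_conjC (v : ℂ ⊗[ℚ] K) (ρ : K →+* ℂ) :
    embeddingCoords K (conjC K v) ρ =
      starRingEnd ℂ (embeddingCoords K v (ComplexEmbedding.conjugate ρ)) := by
  induction v with
  | zero => simp
  | add x y hx hy => simp [hx, hy]
  | tmul z b => simp [conjC]

lemma conjC_conjC (v : ℂ ⊗[ℚ] K) : conjC K (conjC K v) = v := by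
  apply (embeddingCoords K).injective
  ext ρ
  simp [embeddingCoords_conjC]

lemma mem_eigenspaceC_iff {τ : K →+* ℂ} {v : ℂ ⊗[ℚ] K} :
    v ∈ eigenspaceC K K τ ↔ ∀ ρ, ρ ≠ τ → embeddingCoords K v ρ = 0 := by
  refine ⟨fun h ρ hρ ↦ ?_, fun h a ↦ ?_⟩
  · obtain ⟨a, ha⟩ := DFunLike.ne_iff.mp hρ
    have h1 := congrFun (congrArg (embeddingCoords K) (h a)) ρ
    rw [embeddingCoords_actionC, map_smul, Pi.smul_apply, smul_eq_mul] at h1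
    exact (mul_eq_mul_right_iff.mp h1).resolve_left ha
  · apply (embeddingCoords K).injective
    ext ρ
    rw [embeddingCoords_actionC, map_smul, Pi.smul_apply, smul_eq_mul]
    by_cases hρ : ρ = τ
    · rw [hρ]
    · simp [h ρ hρ]

lemma mem_iSup_eigenspaceC_iff {Φ : Set (K →+* ℂ)} {v : ℂ ⊗[ℚ] K} :
    v ∈ ⨆ τ ∈ Φ, eigenspaceC K K τ ↔ ∀ ρ ∉ Φ, embeddingCoords K v ρ = 0 := by
  classical
  refine ⟨fun h ρ hρ ↦ ?_, fun h ↦ ?_⟩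
  · suffices ⨆ τ ∈ Φ, eigenspaceC K K τ ≤
        LinearMap.ker (LinearMap.proj ρ ∘ₗ (embeddingCoords K).toLinearMap) from this h
    exact iSup₂_le fun τ hτ w hw ↦
      mem_eigenspaceC_iff.mp hw ρ fun e ↦ hρ (e ▸ hτ)
  · have hv : v = ∑ ρ, (embeddingCoords K).symm (Pi.single ρ (embeddingCoords K v ρ)) := by
      rw [← map_sum, Finset.univ_sum_single, LinearEquiv.symm_apply_apply]
    rw [hv]
    refine Submodule.sum_mem _ fun ρ _ ↦ ?_
    by_cases hρ : ρ ∈ Φ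
    · refine Submodule.mem_iSup_of_mem ρ (Submodule.mem_iSup_of_mem hρ ?_)
      refine mem_eigenspaceC_iff.mpr fun ρ' h' ↦ ?_
      rw [LinearEquiv.apply_symm_apply, Pi.single_eq_of_ne h']
    · simp [h ρ hρ]

lemma finrank_iSup_eigenspaceC (Φ : Set (K →+* ℂ)) :
    Module.finrank ℂ (⨆ τ ∈ Φ, eigenspaceC K K τ : Submodule ℂ (ℂ ⊗[ℚ] K)) = Φ.ncard := by
  classical
  have hmap : (⨆ τ ∈ Φ, eigenspaceC K K τ).map (embeddingCoords K).toLinearMap =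
      ⨅ ρ ∈ Φᶜ, LinearMap.ker (LinearMap.proj ρ : ((K →+* ℂ) → ℂ) →ₗ[ℂ] ℂ) := by
    ext f
    obtain ⟨v, rfl⟩ := (embeddingCoords K).surjective f
    rw [Submodule.mem_map_equiv, LinearEquiv.symm_apply_apply]
    simp [mem_iSup_eigenspaceC_iff]
  rw [← LinearEquiv.finrank_map_eq (embeddingCoords K), hmap,
    (LinearMap.iInfKerProjEquiv ℂ (fun _ ↦ ℂ) disjoint_compl_right
      (Set.union_compl_self Φ).ge).finrank_eq, Module.finrank_fintype_fun_eq_card,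
    ← Nat.card_eq_fintype_card, Nat.card_coe_set_eq]

lemma baseChange_eq_sum_embeddings {σ : K ≃ₐ[ℚ] K}
    (hσ : ∀ (ρ : K →+* ℂ) (a : K), ρ (σ a) = starRingEnd ℂ (ρ a))
    {B : LinearMap.BilinForm ℚ K} (hB : ∀ x y, B x y = Algebra.trace ℚ K (x * σ y))
    (x y : ℂ ⊗[ℚ] K) :
    B.baseChange ℂ x y = ∑ ρ, embeddingCoords K x ρ *
      embeddingCoords K y (ComplexEmbedding.conjugate ρ) := by
  induction x with
  | zero => simp
  | add x x' hx hx' => simp [hx, hx', add_mul, Finset.sum_add_distrib]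
  | tmul z a =>
    induction y with
    | zero => simp
    | add y y' hy hy' => rw [map_add, hy, hy']; simp [mul_add, Finset.sum_add_distrib]
    | tmul w b =>
      have htr : ((Algebra.trace ℚ K (a * σ b) : ℚ) : ℂ) = ∑ ρ : K →+* ℂ, ρ (a * σ b) := by
        rw [← eq_ratCast (algebraMap ℚ ℂ), trace_eq_sum_embeddings ℂ]
        exact Fintype.sum_equiv (RingHom.equivRatAlgHom K ℂ).symm _ _ fun _ ↦ rfl
      rw [LinearMap.BilinForm.baseChange_tmul, hB, Rat.smul_def, htr, Finset.sum_mul]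
      refine Finset.sum_congr rfl fun ρ _ ↦ ?_
      rw [embeddingCoords_tmul, embeddingCoords_tmul, map_mul, hσ,
        ComplexEmbedding.conjugate_coe_eq]
      ring

lemma ncard_cmType {Φ : Set (K →+* ℂ)}
    (hΦ : ∀ τ, τ ∈ Φ ↔ ComplexEmbedding.conjugate τ ∉ Φ) :
    2 * Φ.ncard = Module.finrank ℚ K := by
  have hcompl : ComplexEmbedding.conjugate ⁻¹' Φ = Φᶜ := by
    ext τ
    simp [hΦ τ]
  have hbij := (ComplexEmbedding.involutive_conjugate K).bijective
  have hcard := Set.ncard_preimage_of_injective_subset_range (s := Φ) hbij.injective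
    (by simp [hbij.surjective.range_eq])
  have hsum := Set.ncard_add_ncard_compl Φ
  rw [← hcompl, hcard, Nat.card_eq_fintype_card, Embeddings.card] at hsum
  omega

end Coordinates

/-- A CM type `Φ` on a CM field `F₀` of degree `2g` yields a polarized
ℚ-Hodge structure of type `(g,0,g)` on `V = F₀`: the subspace `W_Φ = ⨁_{τ∈Φ} V_τ` has
dimension `g`, is isotropic for the twisted trace form, is `F₀`-stable, and satisfies
`V_ℂ = W_Φ ⊕ c(W_Φ)`. -/
theorem cm_type_gives_hodge_structure
    (F₀ : Type*) [Field F₀] [NumberField F₀] (g : ℕ)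
    (hdeg : Module.finrank ℚ F₀ = 2 * g)
    (σ : F₀ ≃ₐ[ℚ] F₀) (hσne : σ ≠ AlgEquiv.refl)
    (hσ : ∀ (ρ : F₀ →+* ℂ) (a : F₀), ρ (σ a) = (starRingEnd ℂ) (ρ a))
    (Φ : Set (F₀ →+* ℂ))
    (hΦ : ∀ τ : F₀ →+* ℂ, Xor' (τ ∈ Φ) (τ.comp (σ : F₀ →ₐ[ℚ] F₀).toRingHom ∈ Φ))
    (B : LinearMap.BilinForm ℚ F₀)
    (hB : ∀ x y : F₀, B x y = Algebra.trace ℚ F₀ (x * σ y))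
    (WΦ : Submodule ℂ (ℂ ⊗[ℚ] F₀))
    (hWΦ : WΦ = ⨆ τ ∈ Φ, eigenspaceC F₀ F₀ τ) :
    Module.finrank ℂ WΦ = g ∧
    (∀ x ∈ WΦ, ∀ y ∈ WΦ, B.baseChange ℂ x y = 0) ∧
    (∀ a : F₀, ∀ w ∈ WΦ, actionC F₀ F₀ a w ∈ WΦ) ∧
    (WΦ.restrictScalars ℚ ⊓ Submodule.map (conjC F₀) (WΦ.restrictScalars ℚ) = ⊥) ∧
    (WΦ.restrictScalars ℚ ⊔ Submodule.map (conjC F₀) (WΦ.restrictScalars ℚ) = ⊤) := by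
  have hconj (τ : F₀ →+* ℂ) :
      τ.comp (σ : F₀ →ₐ[ℚ] F₀).toRingHom = ComplexEmbedding.conjugate τ := RingHom.ext (hσ τ)
  have hΦ' (τ : F₀ →+* ℂ) : τ ∈ Φ ↔ ComplexEmbedding.conjugate τ ∉ Φ := by
    rw [← hconj]
    exact xor_iff_iff_not.mp (hΦ τ)
  have hmem (v : ℂ ⊗[ℚ] F₀) : v ∈ WΦ ↔ ∀ ρ ∉ Φ, embeddingCoords F₀ v ρ = 0 := by
    rw [hWΦ, mem_iSup_eigenspaceC_iff]
  have hmemc (v : ℂ ⊗[ℚ] F₀) : v ∈ (WΦ.restrictScalars ℚ).map (conjC F₀) ↔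
      ∀ ρ ∈ Φ, embeddingCoords F₀ v ρ = 0 := by
    have hv : v ∈ (WΦ.restrictScalars ℚ).map (conjC F₀) ↔ conjC F₀ v ∈ WΦ :=
      ⟨by rintro ⟨w, hw, rfl⟩; rwa [conjC_conjC], fun h ↦ ⟨_, h, conjC_conjC v⟩⟩
    rw [hv, hmem]
    simp only [embeddingCoords_conjC, map_eq_zero]
    refine ⟨fun h ρ hρ ↦ ?_, fun h ρ hρ ↦ h _ (by rwa [hΦ', not_not] at hρ)⟩
    simpa using h _ ((hΦ' ρ).mp hρ)
  refine ⟨?_, fun x hx y hy ↦ ?_, fun a w hw ↦ ?_, ?_, ?_⟩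
  · have h := ncard_cmType hΦ'
    rw [hWΦ, finrank_iSup_eigenspaceC]
    omega
  · rw [baseChange_eq_sum_embeddings hσ hB]
    refine Finset.sum_eq_zero fun ρ _ ↦ ?_
    by_cases hρ : ρ ∈ Φ
    · rw [(hmem y).mp hy _ ((hΦ' ρ).mp hρ), mul_zero]
    · rw [(hmem x).mp hx ρ hρ, zero_mul]
  · refine (hmem _).mpr fun ρ hρ ↦ ?_
    rw [embeddingCoords_actionC, (hmem w).mp hw ρ hρ, mul_zero]
  · refine (Submodule.eq_bot_iff _).mpr fun v hv ↦ (embeddingCoords F₀).injective ?_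
    ext ρ
    rw [map_zero, Pi.zero_apply]
    by_cases hρ : ρ ∈ Φ
    · exact (hmemc v).mp hv.2 ρ hρ
    · exact (hmem v).mp hv.1 ρ hρ
  · classical
    refine Submodule.eq_top_iff'.mpr fun v ↦ Submodule.mem_sup.mpr
      ⟨(embeddingCoords F₀).symm (Φ.indicator (embeddingCoords F₀ v)), ?_,
        (embeddingCoords F₀).symm (Φᶜ.indicator (embeddingCoords F₀ v)), ?_, ?_⟩
    · exact (hmem _).mpr fun ρ hρ ↦ by simp [hρ]
    · exact (hmemc _).mpr fun ρ hρ ↦ by simp [hρ]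
    · rw [← map_add, Set.indicator_self_add_compl, LinearEquiv.symm_apply_apply]
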